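/- Let R : ℕ³ → ℕ satisfy R(0,a,c) = 2c + bit_0(a) and, for all y,a,c ∈ ℕ and i ∈ {0,1} with 2y+i ≠ 0, R(2y+i, a, c) = R(y, ⌊a/2^{2^{|y|}}⌋, R(y, a, c)). Then for all y,a,c ∈ ℕ: R(y,a,c) = c·2^{2^{|y|}} + rev_{2^{|y|}}(a); that is, R(y,a,c) is c concatenated with the 2^{|y|} low-order binary digits of a written in reverse order. -/

import Mathlib

/-- `bit j a` is the `j`-th binary digit of `a`. -/
def bit (j a : ℕ) : ℕ := a / 2 ^ j % 2

/-- `rev n a` : the `n` low-order binary digits of `a`, written in reverse order. -/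
def rev (n a : ℕ) : ℕ := ∑ j ∈ Finset.range n, bit j a * 2 ^ (n - 1 - j)

theorem bit_div_two_pow (j m a : ℕ) : bit j (a / 2 ^ m) = bit (m + j) a := by
  simp only [bit, Nat.div_div_eq_div_mul, pow_add]

theorem rev_add (m n a : ℕ) : rev (m + n) a = rev m a * 2 ^ n + rev n (a / 2 ^ m) := by
  simp only [rev, Finset.sum_range_add, Finset.sum_mul, bit_div_two_pow]
  congr 1
  · refine Finset.sum_congr rfl fun j hj => ?_
    have hj := Finset.mem_range.mp hj
    rw [mul_assoc, ← pow_add]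
    congr 2
    omega
  · refine Finset.sum_congr rfl fun j _ => ?_
    congr 2
    omega

theorem size_two_mul_add {y i : ℕ} (hi : i ≤ 1) (h : 2 * y + i ≠ 0) :
    Nat.size (2 * y + i) = Nat.size y + 1 := by
  interval_cases i
  · exact Nat.size_bit (b := false) (n := y) h
  · exact Nat.size_bit (b := true) (n := y) h

theorem stmt7 (R : ℕ → ℕ → ℕ → ℕ)
    (h0 : ∀ a c, R 0 a c = 2 * c + bit 0 a)
    (hs : ∀ y a c i, i ≤ 1 → 2 * y + i ≠ 0 →
      R (2 * y + i) a c = R y (a / 2 ^ 2 ^ Nat.size y) (R y a c)) :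
    ∀ y a c, R y a c = c * 2 ^ 2 ^ Nat.size y + rev (2 ^ Nat.size y) a := by
  intro y
  induction y using Nat.strong_induction_on with
  | _ y ih =>
    intro a c
    rcases Nat.eq_zero_or_pos y with rfl | hy
    · simp [h0, rev, mul_comm]
    · obtain ⟨z, i, hi, rfl⟩ : ∃ z i, i ≤ 1 ∧ y = 2 * z + i :=
        ⟨y / 2, y % 2, by omega, by omega⟩
      rw [hs z a c i hi hy.ne', size_two_mul_add hi hy.ne', ih z (by omega), ih z (by omega),
        pow_succ 2 (Nat.size z), mul_two, rev_add, pow_add]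
      ring
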